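/- arXiv:1111.0796 — 2 statements merged into one kernel-verified Lean document; each statement's English description precedes it below -/
import Mathlib

section
/- Let s ∈ (0,1) and let f : ℝ → ℝ be of class C^{1,γ} for some γ > max(0, 1−2s), with f′(−1) < 0 and f′(1) < 0. Assume moreover that f is odd: f(−r) = −f(r) for all r. If v is a layer solution of (-∂ₓₓ)^s v = f(v) in ℝ, then v is odd with respect to some point; that is, there exists b ∈ ℝ such that v(x + b) = −v(−x + b) for all x ∈ ℝ. -/
open Real MeasureTheory Filter Set

/-- Normalizing constant of the one-dimensional fractional Laplacian. -/
noncomputable def fracLapCoef (s : ℝ) : ℝ :=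
  (4:ℝ) ^ s * s * Real.Gamma (s + 1/2) / (Real.sqrt π * Real.Gamma (1 - s))

/-- The one-dimensional fractional Laplacian `(-∂ₓₓ)^s v (x)`. -/
noncomputable def fracLap (s : ℝ) (v : ℝ → ℝ) (x : ℝ) : ℝ :=
  fracLapCoef s * ∫ y in Set.Ioi (0:ℝ), (2 * v x - v (x + y) - v (x - y)) * y ^ (-1 - 2*s)

/-- `f` is of class `C^{1,γ}`: continuously differentiable with `γ`-Hölder derivative. -/
def IsC1Holder (γ : ℝ) (f : ℝ → ℝ) : Prop :=
  ContDiff ℝ 1 f ∧ ∃ C : ℝ, ∀ x y : ℝ, |deriv f x - deriv f y| ≤ C * |x - y| ^ γ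

/-- A layer solution of `(-∂ₓₓ)^s v = f(v)` in `ℝ`. -/
structure IsLayerSolution (s : ℝ) (f : ℝ → ℝ) (v : ℝ → ℝ) : Prop where
  bounded : ∃ M : ℝ, ∀ x, |v x| ≤ M
  smooth : ContDiff ℝ 2 v
  eqn : ∀ x, fracLap s v x = f (v x)
  mono : ∀ x, 0 < deriv v x
  limNeg : Tendsto v atBot (nhds (-1))
  limPos : Tendsto v atTop (nhds 1)

/-- The potential `G(r) = -∫₀^r f`. -/
noncomputable def potG (f : ℝ → ℝ) (r : ℝ) : ℝ := -∫ u in (0:ℝ)..r, f u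

theorem aux_coef_pos (s : ℝ) (hs : s ∈ Set.Ioo (0:ℝ) 1) : 0 < fracLapCoef s := by
  obtain ⟨h0, h1⟩ := hs
  have hG1 : 0 < Real.Gamma (s + 1/2) := Real.Gamma_pos_of_pos (by linarith)
  have hG2 : 0 < Real.Gamma (1 - s) := Real.Gamma_pos_of_pos (by linarith)
  have hpi : 0 < Real.sqrt π := Real.sqrt_pos.mpr Real.pi_pos
  have h4 : 0 < (4:ℝ) ^ s := Real.rpow_pos_of_pos (by norm_num) s
  unfold fracLapCoef
  positivity

/-- second-order difference bound near zero -/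
theorem aux_second_diff (v : ℝ → ℝ) (hv : ContDiff ℝ 2 v) (x : ℝ) :
    ∃ L : ℝ, ∀ y ∈ Set.Ioc (0:ℝ) 1, |2 * v x - v (x + y) - v (x - y)| ≤ L * y ^ 2 := by
  have hd : Differentiable ℝ v := hv.differentiable (by norm_num)
  have hd1 : ContDiff ℝ 1 (deriv v) := by
    have : ContDiff ℝ (1 + 1) v := by simpa [one_add_one_eq_two] using hv
    exact (contDiff_succ_iff_deriv.mp this).2.2
  have hdd : Differentiable ℝ (deriv v) := hd1.differentiable (by norm_num)
  have hcc : Continuous (deriv (deriv v)) := hd1.continuous_deriv (by norm_num)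
  obtain ⟨K, hK⟩ := (isCompact_Icc (a := x - 1) (b := x + 1)).exists_bound_of_continuousOn
    hcc.continuousOn
  have hLip : ∀ a ∈ Set.Icc (x-1) (x+1), ∀ b ∈ Set.Icc (x-1) (x+1),
      |deriv v b - deriv v a| ≤ K * |b - a| := by
    intro a ha b hb
    have := (convex_Icc (x-1) (x+1)).norm_image_sub_le_of_norm_deriv_le
      (f := deriv v) (C := K) (fun z _ => hdd z) hK ha hb
    simpa [Real.norm_eq_abs] using this
  have hK0 : 0 ≤ K := le_trans (norm_nonneg _) (hK x ⟨by linarith, by linarith⟩)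
  refine ⟨2 * K, ?_⟩
  intro y hy
  obtain ⟨hy0, hy1⟩ := hy
  have hder : ∀ z, HasDerivAt (fun y => 2 * v x - v (x + y) - v (x - y))
      (- deriv v (x + z) + deriv v (x - z)) z := by
    intro z
    have h1 : HasDerivAt (fun y => v (x + y)) (deriv v (x + z)) z := by
      simpa using (hd (x+z)).hasDerivAt.comp_const_add x z
    have h2 : HasDerivAt (fun y => v (x - y)) (-deriv v (x - z)) z := by
      simpa using (hd (x-z)).hasDerivAt.comp_const_sub x z
    have := ((hasDerivAt_const z (2 * v x)).sub h1).sub h2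
    exact this.congr_deriv (by ring)
  have := (convex_Icc (0:ℝ) y).norm_image_sub_le_of_norm_hasDerivWithin_le
    (f := fun y => 2 * v x - v (x + y) - v (x - y)) (C := 2 * K * y)
    (fun z _ => (hder z).hasDerivWithinAt) (by
      intro z hz
      have := hLip (x+z) ⟨by linarith [hz.1], by linarith [hz.2]⟩ (x-z)
        ⟨by linarith [hz.2], by linarith [hz.1]⟩
      have e : |x - z - (x + z)| = 2 * z := by
        rw [show x - z - (x+z) = -(2*z) by ring, abs_neg, abs_of_nonneg (by linarith [hz.1])]
      rw [e] at this
      rw [Real.norm_eq_abs, show - deriv v (x + z) + deriv v (x - z)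
        = deriv v (x - z) - deriv v (x + z) by ring]
      refine this.trans ?_
      nlinarith [hz.2])
    (left_mem_Icc.mpr hy0.le) (right_mem_Icc.mpr hy0.le)
  simp only [Real.norm_eq_abs, add_zero, sub_zero] at this
  rw [show 2 * v x - v x - v x = 0 by ring, sub_zero, abs_of_pos hy0] at this
  linarith

theorem aux_integrable (s : ℝ) (hs : s ∈ Set.Ioo (0:ℝ) 1) (v : ℝ → ℝ) (hv : ContDiff ℝ 2 v)
    (M : ℝ) (hM : ∀ x, |v x| ≤ M) (x : ℝ) :
    IntegrableOn (fun y => (2 * v x - v (x + y) - v (x - y)) * y ^ (-1 - 2*s)) (Set.Ioi 0) := by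
  obtain ⟨h0, h1⟩ := hs
  have hc : Continuous v := hv.continuous
  have hmeas : Measurable
      (fun y : ℝ => (2 * v x - v (x + y) - v (x - y)) * y ^ (-1 - 2*s)) := by
    have : Measurable (fun y : ℝ => 2 * v x - v (x + y) - v (x - y)) :=
      (by fun_prop : Continuous (fun y : ℝ => 2 * v x - v (x + y) - v (x - y))).measurable
    exact this.mul (measurable_id.pow_const _)
  rw [← Set.Ioc_union_Ioi_eq_Ioi (zero_le_one (α := ℝ))]
  refine IntegrableOn.union ?_ ?_
  · obtain ⟨L, hL⟩ := aux_second_diff v hv x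
    have hi : IntegrableOn (fun y : ℝ => L * y ^ (1 - 2*s)) (Set.Ioc 0 1) := by
      have := (intervalIntegral.intervalIntegrable_rpow' (a := 0) (b := 1)
        (r := 1 - 2*s) (by linarith)).const_mul L
      rwa [intervalIntegrable_iff_integrableOn_Ioc_of_le zero_le_one] at this
    refine Integrable.mono' hi hmeas.aestronglyMeasurable ?_
    refine (ae_restrict_iff' measurableSet_Ioc).mpr (Eventually.of_forall fun y hy => ?_)
    have hp : 0 ≤ y ^ (-1 - 2*s) := Real.rpow_nonneg hy.1.le _
    rw [norm_mul, Real.norm_eq_abs, Real.norm_eq_abs, abs_of_nonneg hp]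
    have e : y ^ (1 - 2*s) = y ^ 2 * y ^ (-1 - 2*s) := by
      rw [show (1 - 2*s) = 2 + (-1 - 2*s) by ring, Real.rpow_add hy.1, Real.rpow_two]
    rw [e, ← mul_assoc]
    exact mul_le_mul_of_nonneg_right (hL y hy) hp
  · have hi : IntegrableOn (fun y : ℝ => (4 * M) * y ^ (-1 - 2*s)) (Set.Ioi 1) :=
      (integrableOn_Ioi_rpow_of_lt (by linarith) zero_lt_one).const_mul _
    refine Integrable.mono' hi hmeas.aestronglyMeasurable ?_
    refine (ae_restrict_iff' measurableSet_Ioi).mpr (Eventually.of_forall fun y hy => ?_)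
    have hp : 0 ≤ y ^ (-1 - 2*s) := Real.rpow_nonneg (zero_le_one.trans (le_of_lt hy)) _
    rw [norm_mul, Real.norm_eq_abs, Real.norm_eq_abs, abs_of_nonneg hp]
    refine mul_le_mul_of_nonneg_right ?_ hp
    have a1 := abs_le.mp (hM x)
    have a2 := abs_le.mp (hM (x+y))
    have a3 := abs_le.mp (hM (x-y))
    rw [abs_le]
    constructor <;> linarith

theorem aux_cmp (s : ℝ) (hs : s ∈ Set.Ioo (0:ℝ) 1) (v w : ℝ → ℝ)
    (hv : ContDiff ℝ 2 v) (hw : ContDiff ℝ 2 w)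
    (hMv : ∀ x, |v x| ≤ 1) (hMw : ∀ x, |w x| ≤ 1) (x : ℝ)
    (hmin : ∀ z, w x - v x ≤ w z - v z) : fracLap s w x ≤ fracLap s v x := by
  unfold fracLap
  refine mul_le_mul_of_nonneg_left ?_ (aux_coef_pos s hs).le
  refine setIntegral_mono_on (aux_integrable s hs w hw 1 hMw x)
    (aux_integrable s hs v hv 1 hMv x) measurableSet_Ioi ?_
  intro y hy
  have hp : 0 ≤ y ^ (-1 - 2*s) := Real.rpow_nonneg (le_of_lt hy) _
  refine mul_le_mul_of_nonneg_right ?_ hp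
  linarith [hmin (x+y), hmin (x-y)]

theorem aux_touch (s : ℝ) (hs : s ∈ Set.Ioo (0:ℝ) 1) (v w : ℝ → ℝ)
    (hv : ContDiff ℝ 2 v) (hw : ContDiff ℝ 2 w)
    (hMv : ∀ x, |v x| ≤ 1) (hMw : ∀ x, |w x| ≤ 1) (x : ℝ)
    (hle : ∀ z, v z ≤ w z) (hx : w x = v x) (heq : fracLap s w x = fracLap s v x) :
    ∀ z, v z = w z := by
  have hcv : Continuous v := hv.continuous
  have hcw : Continuous w := hw.continuous
  have hIv := aux_integrable s hs v hv 1 hMv x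
  have hIw := aux_integrable s hs w hw 1 hMw x
  unfold fracLap at heq
  have heq' := mul_left_cancel₀ (aux_coef_pos s hs).ne' heq
  have hsub := integral_sub hIv hIw
  rw [heq', sub_self] at hsub
  have hnn : ∀ y ∈ Set.Ioi (0:ℝ), 0 ≤ (2 * v x - v (x + y) - v (x - y)) * y ^ (-1 - 2*s)
      - (2 * w x - w (x + y) - w (x - y)) * y ^ (-1 - 2*s) := by
    intro y hy
    have hp : 0 ≤ y ^ (-1 - 2*s) := Real.rpow_nonneg (le_of_lt hy) _
    rw [← sub_mul]
    refine mul_nonneg ?_ hp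
    linarith [hle (x+y), hle (x-y)]
  have hae := (setIntegral_eq_zero_iff_of_nonneg_ae
    ((ae_restrict_iff' measurableSet_Ioi).mpr (Eventually.of_forall hnn)) (hIv.sub hIw)).mp hsub
  have hcont : ContinuousOn (fun y => (2 * v x - v (x + y) - v (x - y)) * y ^ (-1 - 2*s)
      - (2 * w x - w (x + y) - w (x - y)) * y ^ (-1 - 2*s)) (Set.Ioi (0:ℝ)) := by
    have hr : ContinuousOn (fun y : ℝ => y ^ (-1 - 2*s)) (Set.Ioi (0:ℝ)) :=
      fun y hy => (Real.continuousAt_rpow_const y _ (Or.inl (ne_of_gt hy))).continuousWithinAt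
    refine ContinuousOn.sub (ContinuousOn.mul ?_ hr) (ContinuousOn.mul ?_ hr)
    · exact Continuous.continuousOn (by fun_prop)
    · exact Continuous.continuousOn (by fun_prop)
  have hzero := MeasureTheory.Measure.eqOn_open_of_ae_eq hae isOpen_Ioi hcont continuousOn_const
  have key : ∀ y, 0 < y → v (x + y) = w (x + y) ∧ v (x - y) = w (x - y) := by
    intro y hy
    have h := hzero (show y ∈ Set.Ioi (0:ℝ) from hy)
    have hp : 0 < y ^ (-1 - 2*s) := Real.rpow_pos_of_pos hy _
    simp only [Pi.zero_apply] at h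
    rw [← sub_mul] at h
    have h2 := (mul_eq_zero.mp h).resolve_right hp.ne'
    constructor <;> linarith [hle (x+y), hle (x-y)]
  intro z
  rcases lt_trichotomy z x with h | h | h
  · have := (key (x - z) (by linarith)).2
    simpa using this
  · rw [h, hx]
  · have := (key (z - x) (by linarith)).1
    simpa using this

theorem aux_maxprin (s : ℝ) (hs : s ∈ Set.Ioo (0:ℝ) 1) (f v w : ℝ → ℝ) (δ : ℝ)
    (hA : ∀ a b, 1 - δ ≤ a → a < b → b ≤ 1 → f b < f a)
    (hB : ∀ a b, -1 ≤ a → a < b → b ≤ -1 + δ → f b < f a)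
    (hv : ContDiff ℝ 2 v) (hw : ContDiff ℝ 2 w)
    (hMv : ∀ x, |v x| ≤ 1) (hMw : ∀ x, |w x| ≤ 1)
    (hev : ∀ x, fracLap s v x = f (v x)) (hew : ∀ x, fracLap s w x = f (w x))
    (hvn : Tendsto v atBot (nhds (-1))) (hvp : Tendsto v atTop (nhds 1))
    (hwn : Tendsto w atBot (nhds (-1))) (hwp : Tendsto w atTop (nhds 1))
    (H : ∀ x, w x < v x → 1 - δ ≤ w x ∨ v x ≤ -1 + δ) : ∀ x, v x ≤ w x := by
  by_contra hcon
  push Not at hcon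
  obtain ⟨x0, hx0⟩ := hcon
  have hneg : w x0 - v x0 < 0 := by linarith
  obtain ⟨x, hx⟩ := (hw.continuous.sub hv.continuous).exists_forall_le' x0 (by
    rw [cocompact_eq_atBot_atTop, eventually_sup]
    constructor
    · have h := hwn.sub hvn
      rw [sub_self] at h
      exact (h.eventually_const_lt hneg).mono fun z hz => le_of_lt hz
    · have h := hwp.sub hvp
      rw [sub_self] at h
      exact (h.eventually_const_lt hneg).mono fun z hz => le_of_lt hz)
  have hx' : ∀ z, w x - v x ≤ w z - v z := hx
  have hlt : w x < v x := by linarith [hx' x0]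
  have h1 := aux_cmp s hs v w hv hw hMv hMw x hx'
  rw [hev, hew] at h1
  have a1 := abs_le.mp (hMv x)
  have a2 := abs_le.mp (hMw x)
  rcases H x hlt with h | h
  · linarith [hA _ _ h hlt a1.2]
  · linarith [hB _ _ a2.1 hlt h]

theorem aux_anti (f : ℝ → ℝ) (hf : ContDiff ℝ 1 f) (hfp : deriv f 1 < 0) :
    ∃ δ > 0, ∀ a b, 1 - δ ≤ a → a < b → b ≤ 1 → f b < f a := by
  have hc : Continuous (deriv f) := hf.continuous_deriv (by norm_num)
  have hev := hc.continuousAt.eventually_lt_const hfp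
  obtain ⟨ε, hε, hb⟩ := Metric.eventually_nhds_iff.mp hev
  refine ⟨ε / 2, by linarith, ?_⟩
  have hanti : StrictAntiOn f (Set.Icc (1 - ε/2) 1) := by
    refine strictAntiOn_of_deriv_neg (convex_Icc _ _) hf.continuous.continuousOn ?_
    intro x hx
    rw [interior_Icc] at hx
    refine hb ?_
    rw [Real.dist_eq, abs_lt]
    constructor <;> linarith [hx.1, hx.2]
  intro a b h1 h2 h3
  exact hanti ⟨h1, by linarith⟩ ⟨by linarith, h3⟩ h2

theorem aux_sliding (s : ℝ) (hs : s ∈ Set.Ioo (0:ℝ) 1) (f v w : ℝ → ℝ) (δ : ℝ) (hδ : 0 < δ)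
    (hA : ∀ a b, 1 - δ ≤ a → a < b → b ≤ 1 → f b < f a)
    (hB : ∀ a b, -1 ≤ a → a < b → b ≤ -1 + δ → f b < f a)
    (hv : ContDiff ℝ 2 v) (hw : ContDiff ℝ 2 w)
    (hMv : ∀ x, |v x| ≤ 1) (hMw : ∀ x, |w x| ≤ 1)
    (hmv : StrictMono v) (hmw : StrictMono w)
    (hev : ∀ x, fracLap s v x = f (v x)) (hew : ∀ x, fracLap s w x = f (w x))
    (hvn : Tendsto v atBot (nhds (-1))) (hvp : Tendsto v atTop (nhds 1))
    (hwn : Tendsto w atBot (nhds (-1))) (hwp : Tendsto w atTop (nhds 1)) :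
    ∃ t : ℝ, ∀ x, v x = w (x + t) := by
  have hwt : ∀ t, ContDiff ℝ 2 (fun x => w (x + t)) := fun t =>
    hw.comp (contDiff_id.add contDiff_const)
  have hMt : ∀ t x, |w (x + t)| ≤ 1 := fun t x => hMw _
  have het : ∀ t x, fracLap s (fun x => w (x + t)) x = f (w (x + t)) := by
    intro t x
    rw [← hew (x + t)]
    unfold fracLap
    congr 2
    ext y
    beta_reduce
    rw [show x + y + t = x + t + y by ring, show x - y + t = x + t - y by ring]
  have hnt : ∀ t, Tendsto (fun x => w (x + t)) atBot (nhds (-1)) := fun t =>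
    hwn.comp (tendsto_atBot_add_const_right _ t tendsto_id)
  have hpt : ∀ t, Tendsto (fun x => w (x + t)) atTop (nhds 1) := fun t =>
    hwp.comp (tendsto_atTop_add_const_right _ t tendsto_id)
  have hMP : ∀ t, (∀ x, w (x + t) < v x → 1 - δ ≤ w (x + t) ∨ v x ≤ -1 + δ) →
      ∀ x, v x ≤ w (x + t) := fun t H =>
    aux_maxprin s hs f v (fun x => w (x + t)) δ hA hB hv (hwt t) hMv (hMt t) hev (het t)
      hvn hvp (hnt t) (hpt t) H
  obtain ⟨P, hP⟩ := (hwp.eventually_const_le (show 1 - δ < 1 by linarith)).exists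
  obtain ⟨N, hN⟩ := (hvn.eventually_le_const (show -1 < -1 + δ by linarith)).exists
  set T : Set ℝ := {t | ∀ x, v x ≤ w (x + t)} with hT
  have hne : T.Nonempty := by
    refine ⟨P - N, hMP _ fun x _ => ?_⟩
    rcases le_total x N with h | h
    · exact Or.inr ((hmv.monotone h).trans hN)
    · exact Or.inl (hP.trans (hmw.monotone (by linarith)))
  have hbd : BddBelow T := by
    have h0 : -1 < v 0 := lt_of_le_of_lt (abs_le.mp (hMv (-1))).1 (hmv (by norm_num))
    obtain ⟨q, hq⟩ := (hwn.eventually_lt_const h0).exists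
    refine ⟨q, fun t ht => ?_⟩
    by_contra hlt
    push Not at hlt
    have h1 := ht 0
    rw [zero_add] at h1
    linarith [hmw hlt]
  have hclosed : IsClosed T := by
    rw [hT, Set.ofPred_forall]
    refine isClosed_iInter fun x => ?_
    have := hw.continuous
    exact isClosed_le continuous_const (by fun_prop)
  set t0 := sInf T with ht0
  have ht0T : ∀ x, v x ≤ w (x + t0) := hclosed.csInf_mem hne hbd
  refine ⟨t0, ?_⟩
  by_cases htouch : ∃ x, w (x + t0) = v x
  · obtain ⟨x, hx⟩ := htouch
    refine aux_touch s hs v (fun x => w (x + t0)) hv (hwt t0) hMv (hMt t0) x ht0T hx ?_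
    rw [het, hev, hx]
  · exfalso
    push Not at htouch
    have hstrict : ∀ x, v x < w (x + t0) := fun x => lt_of_le_of_ne (ht0T x) (htouch x).symm
    -- compact region
    set R : ℝ := P - t0 + 1 with hR
    have hcont : Continuous (fun p : ℝ × ℝ => w (p.1 + p.2) - v p.1) := by
      have := hw.continuous
      have := hv.continuous
      fun_prop
    have hex : ∃ ε > 0, ε < 1 ∧ ∀ x ∈ Set.Icc N R, v x < w (x + (t0 - ε)) := by
      have hev2 : ∀ᶠ t in nhds t0, ∀ x ∈ Set.Icc N R, 0 < w (x + t) - v x := by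
        refine (isCompact_Icc (a := N) (b := R)).eventually_forall_of_forall_eventually ?_
        intro x _
        have h0 : 0 < w (x + t0) - v x := by linarith [hstrict x]
        have hc2 : Continuous (fun p : ℝ × ℝ => w (p.2 + p.1) - v p.2) := by
          have := hw.continuous
          have := hv.continuous
          fun_prop
        first
        | exact (hcont.continuousAt (x := (x, t0))).eventually_const_lt h0
        | exact (hc2.continuousAt (x := (t0, x))).eventually_const_lt h0
      obtain ⟨ε, hε, hb⟩ := Metric.eventually_nhds_iff.mp hev2
      refine ⟨min (ε/2) (1/2), by positivity, by
        exact lt_of_le_of_lt (min_le_right _ _) (by norm_num), fun x hx => ?_⟩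
      have hm : 0 < min (ε/2) (1/2) := by positivity
      have := hb (y := t0 - min (ε/2) (1/2)) (by
        rw [Real.dist_eq, sub_sub_cancel_left, abs_neg, abs_of_pos hm]
        exact lt_of_le_of_lt (min_le_left _ _) (by linarith)) x hx
      linarith
    obtain ⟨ε, hε, hε1, hcomp⟩ := hex
    have hmem : t0 - ε ∈ T := by
      refine hMP _ fun x hx => ?_
      rcases le_total x N with h | h
      · exact Or.inr ((hmv.monotone h).trans hN)
      · rcases le_total x R with h' | h'
        · linarith [hcomp x ⟨h, h'⟩]
        · exact Or.inl (hP.trans (hmw.monotone (by linarith)))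
    linarith [csInf_le hbd hmem]

/-- For odd nonlinearities, the layer solution is odd with respect to some point. -/
theorem statement3 (s γ : ℝ) (hs : s ∈ Set.Ioo (0:ℝ) 1)
    (hγ : max 0 (1 - 2*s) < γ)
    (f : ℝ → ℝ) (hf : IsC1Holder γ f)
    (hfm : deriv f (-1) < 0) (hfp : deriv f 1 < 0)
    (hodd : ∀ r : ℝ, f (-r) = -f r)
    (v : ℝ → ℝ) (hv : IsLayerSolution s f v) :
    ∃ b : ℝ, ∀ x : ℝ, v (x + b) = -v (-x + b) := by
  obtain ⟨δ, hδ, hA⟩ := aux_anti f hf.1 hfp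
  have hB : ∀ a b, -1 ≤ a → a < b → b ≤ -1 + δ → f b < f a := by
    intro a b h1 h2 h3
    have := hA (-b) (-a) (by linarith) (by linarith) (by linarith)
    rw [hodd, hodd] at this
    linarith
  have hmono : StrictMono v := strictMono_of_deriv_pos hv.mono
  have hM : ∀ x, |v x| ≤ 1 := fun x =>
    abs_le.mpr ⟨hmono.monotone.le_of_tendsto hv.limNeg x, hmono.monotone.ge_of_tendsto hv.limPos x⟩
  have hew : ∀ x, fracLap s (fun z => -v (-z)) x = f (-v (-x)) := by
    intro x
    rw [hodd, ← hv.eqn (-x)]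
    unfold fracLap
    rw [← mul_neg, ← integral_neg]
    congr 2
    ext y
    beta_reduce
    rw [show -(x + y) = -x - y by ring, show -(x - y) = -x + y by ring]
    ring
  obtain ⟨t, ht⟩ := aux_sliding s hs f v (fun z => -v (-z)) δ hδ hA hB hv.smooth
    (hv.smooth.comp contDiff_neg).neg hM (fun x => by rw [abs_neg]; exact hM _) hmono
    (fun a b hab => neg_lt_neg (hmono (neg_lt_neg hab))) hv.eqn hew hv.limNeg hv.limPos
    (hv.limPos.comp tendsto_neg_atBot_atTop).neg
    (by simpa using (hv.limNeg.comp tendsto_neg_atTop_atBot).neg)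
  refine ⟨-t/2, fun x => ?_⟩
  rw [ht (x + -t/2)]
  congr 2
  ring
end

section
/- Let s ∈ (0,1) and let f : ℝ → ℝ be of class C^{1,γ} for some γ > max(0, 1−2s), with f′(−1) < 0 and f′(1) < 0. Let v be a layer solution of (-∂ₓₓ)^s v = f(v) in ℝ. Then there exist constants 0 < c ≤ C such that c x^{−2s} ≤ 1 − v(x) ≤ C x^{−2s} for all x > 1, and c |x|^{−2s} ≤ 1 + v(x) ≤ C |x|^{−2s} for all x < −1. -/
open Real MeasureTheory Filter Set

open Topology

/-- The unnormalized integral. -/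
noncomputable def JJ (s : ℝ) (v : ℝ → ℝ) (x : ℝ) : ℝ :=
  ∫ y in Set.Ioi (0:ℝ), (2 * v x - v (x + y) - v (x - y)) * y ^ (-1 - 2*s)

lemma coef_pos {s : ℝ} (hs : s ∈ Set.Ioo (0:ℝ) 1) : 0 < fracLapCoef s := by
  obtain ⟨h0, h1⟩ := hs
  unfold fracLapCoef
  have := Real.Gamma_pos_of_pos (show 0 < s + 1/2 by linarith)
  have := Real.Gamma_pos_of_pos (show 0 < 1 - s by linarith)
  have := Real.pi_pos
  positivity

lemma second_diff {v : ℝ → ℝ} (hv : Differentiable ℝ v) {x K : ℝ} (hK : 0 ≤ K)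
    (hL : ∀ a ∈ Set.Icc (x-1) (x+1), ∀ b ∈ Set.Icc (x-1) (x+1),
      |deriv v a - deriv v b| ≤ K * |a - b|) {y : ℝ} (hy : y ∈ Set.Icc (0:ℝ) 1) :
    |2 * v x - v (x + y) - v (x - y)| ≤ 2 * K * y^2 := by
  have hd : ∀ z : ℝ, HasDerivAt (fun z => 2 * v x - v (x + z) - v (x - z))
      (- deriv v (x+z) + deriv v (x - z)) z := by
    intro z
    have h1 : HasDerivAt (fun z => v (x + z)) (deriv v (x+z)) z :=
      HasDerivAt.comp_const_add x z (hv (x+z)).hasDerivAt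
    have h2 : HasDerivAt (fun z => v (x - z)) (- deriv v (x-z)) z :=
      HasDerivAt.comp_const_sub x z (hv (x-z)).hasDerivAt
    have h3 := (h1.const_sub (2 * v x)).sub h2
    rwa [sub_neg_eq_add] at h3
  have := Convex.norm_image_sub_le_of_norm_hasDerivWithin_le
    (f := fun z => 2 * v x - v (x + z) - v (x - z)) (s := Set.Icc 0 y) (C := 2 * K * y)
    (x := 0) (y := y)
    (fun z _ => (hd z).hasDerivWithinAt) (fun z hz => ?_) (convex_Icc 0 y)
    ⟨le_rfl, hy.1⟩ ⟨hy.1, le_rfl⟩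
  · simp only [Real.norm_eq_abs, add_zero, sub_zero] at this
    rw [abs_of_nonneg hy.1] at this
    have e : 2 * v x - v (x + y) - v (x - y) - (2 * v x - v x - v x)
      = 2 * v x - v (x + y) - v (x - y) := by ring
    rw [e] at this
    calc _ ≤ _ := this
      _ = _ := by ring
  · have h1 := hL (x - z) ⟨by linarith [hz.2, hy.2], by linarith [hz.1]⟩ (x+z)
      ⟨by linarith [hz.1], by linarith [hz.2, hy.2]⟩
    rw [Real.norm_eq_abs]
    have e : x - z - (x + z) = -(2*z) := by ring
    rw [e, abs_neg, abs_of_nonneg (show 0 ≤ 2 * z by linarith [hz.1])] at h1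
    rw [show - deriv v (x+z) + deriv v (x - z) = deriv v (x - z) - deriv v (x+z) by ring]
    nlinarith [hz.2]

/-- the dominating function -/
noncomputable def domF (s K B : ℝ) (y : ℝ) : ℝ :=
  if y ≤ 1 then 2 * K * y ^ (1 - 2*s) else 4 * B * y ^ (-1 - 2*s)

lemma domF_int {s : ℝ} (hs : s ∈ Set.Ioo (0:ℝ) 1) (K B : ℝ) :
    IntegrableOn (domF s K B) (Set.Ioi 0) := by
  rw [← Set.Ioc_union_Ioi_eq_Ioi (zero_le_one (α := ℝ))]
  refine IntegrableOn.union ?_ ?_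
  · have : IntegrableOn (fun y : ℝ => 2 * K * y ^ (1 - 2*s)) (Set.Ioc 0 1) := by
      have h := intervalIntegral.intervalIntegrable_rpow' (a := 0) (b := 1) (r := 1 - 2*s)
        (by linarith [hs.2])
      rw [intervalIntegrable_iff_integrableOn_Ioc_of_le zero_le_one] at h
      exact h.const_mul _
    refine this.congr_fun (fun y hy => ?_) measurableSet_Ioc
    simp [domF, hy.2]
  · have : IntegrableOn (fun y : ℝ => 4 * B * y ^ (-1 - 2*s)) (Set.Ioi 1) :=
      (integrableOn_Ioi_rpow_of_lt (by linarith [hs.1]) one_pos).const_mul _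
    refine this.congr_fun (fun y hy => ?_) measurableSet_Ioi
    simp [domF, not_le.mpr (Set.mem_Ioi.mp hy)]

lemma dom_bound {s : ℝ} {v : ℝ → ℝ} (hv : Differentiable ℝ v)
    {x K B : ℝ} (hK : 0 ≤ K) (hB : ∀ x, |v x| ≤ B)
    (hL : ∀ a ∈ Set.Icc (x-1) (x+1), ∀ b ∈ Set.Icc (x-1) (x+1),
      |deriv v a - deriv v b| ≤ K * |a - b|) {y : ℝ} (hy : 0 < y) :
    ‖(2 * v x - v (x + y) - v (x - y)) * y ^ (-1 - 2*s)‖ ≤ domF s K B y := by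
  have hp : 0 ≤ y ^ (-1 - 2*s) := Real.rpow_nonneg hy.le _
  rw [norm_mul, Real.norm_eq_abs, Real.norm_eq_abs, abs_of_nonneg hp, domF]
  split_ifs with h
  · have := second_diff hv hK hL ⟨hy.le, h⟩
    calc _ ≤ 2 * K * y^2 * y ^ (-1 - 2*s) := by gcongr
      _ = _ := by
        rw [mul_assoc, ← Real.rpow_natCast y 2, ← Real.rpow_add hy]
        congr 2; push_cast; ring
  · gcongr
    have h1 := abs_le.mp (hB x)
    have h2 := abs_le.mp (hB (x+y))
    have h3 := abs_le.mp (hB (x-y))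
    rw [abs_le]; constructor <;> linarith

lemma JJ_aesm {s : ℝ} {v : ℝ → ℝ} (hv : Continuous v) (x : ℝ) :
    AEStronglyMeasurable (fun y => (2 * v x - v (x + y) - v (x - y)) * y ^ (-1 - 2*s))
      (volume.restrict (Set.Ioi (0:ℝ))) := by
  refine ContinuousOn.aestronglyMeasurable ?_ measurableSet_Ioi
  refine ContinuousOn.mul (by fun_prop) ?_
  exact ContinuousOn.rpow_const continuousOn_id (fun y hy => Or.inl (ne_of_gt hy))

lemma JJ_int' {s : ℝ} (hs : s ∈ Set.Ioo (0:ℝ) 1) {v : ℝ → ℝ} (hv : Differentiable ℝ v)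
    {x K B : ℝ} (hK : 0 ≤ K) (hB : ∀ x, |v x| ≤ B)
    (hL : ∀ a ∈ Set.Icc (x-1) (x+1), ∀ b ∈ Set.Icc (x-1) (x+1),
      |deriv v a - deriv v b| ≤ K * |a - b|) :
    IntegrableOn (fun y => (2 * v x - v (x + y) - v (x - y)) * y ^ (-1 - 2*s)) (Set.Ioi 0) := by
  refine Integrable.mono' (domF_int hs K B) (JJ_aesm hv.continuous x) ?_
  refine (ae_restrict_iff' measurableSet_Ioi).mpr (Eventually.of_forall fun y hy => ?_)
  exact dom_bound hv hK hB hL hy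

lemma JJ_int {s : ℝ} (hs : s ∈ Set.Ioo (0:ℝ) 1) {v : ℝ → ℝ} (hv : ContDiff ℝ 2 v)
    {B : ℝ} (hB : ∀ x, |v x| ≤ B) (x : ℝ) :
    IntegrableOn (fun y => (2 * v x - v (x + y) - v (x - y)) * y ^ (-1 - 2*s)) (Set.Ioi 0) := by
  have hd : ContDiff ℝ 1 (deriv v) := by
    have : ContDiff ℝ (1+1) v := by simpa [one_add_one_eq_two] using hv
    exact (contDiff_succ_iff_deriv.mp this).2.2
  have hc : Continuous (deriv (deriv v)) := hd.continuous_deriv le_rfl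
  obtain ⟨K, hK⟩ := (isCompact_Icc (a := x-1) (b := x+1)).exists_bound_of_continuousOn
    hc.continuousOn
  have hK0 : 0 ≤ K := le_trans (norm_nonneg _) (hK x ⟨by linarith, by linarith⟩)
  refine JJ_int' hs (hv.differentiable (by norm_num)) hK0 hB ?_
  intro a ha b hb
  exact Convex.norm_image_sub_le_of_norm_deriv_le
    (fun z _ => (hd.differentiable (by norm_num)) z) hK (convex_Icc _ _) hb ha

lemma JJ_add {s : ℝ} (hs : s ∈ Set.Ioo (0:ℝ) 1) {v w : ℝ → ℝ} (hv : ContDiff ℝ 2 v)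
    {B : ℝ} (hB : ∀ x, |v x| ≤ B) (hw : ContDiff ℝ 2 w)
    {B' : ℝ} (hB' : ∀ x, |w x| ≤ B') (h : ℝ) (x : ℝ) :
    JJ s (fun x => v x + h * w x) x = JJ s v x + h * JJ s w x := by
  unfold JJ
  rw [← integral_const_mul, ← integral_add (JJ_int hs hv hB x) ((JJ_int hs hw hB' x).const_mul h)]
  congr 1; ext y; ring

lemma JJ_neg {s : ℝ} (v : ℝ → ℝ) (x : ℝ) :
    JJ s (fun x => - v x) x = - JJ s v x := by
  unfold JJ
  rw [← integral_neg]
  congr 1; ext y; ring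

lemma JJ_refl {s : ℝ} (v : ℝ → ℝ) (x : ℝ) :
    JJ s (fun x => v (-x)) x = JJ s v (-x) := by
  unfold JJ
  congr 1; ext y
  simp only
  rw [show -(x+y) = -x - y by ring, show -(x-y) = -x+y by ring]
  ring

lemma JJ_scale {s : ℝ} (v : ℝ → ℝ) (t : ℝ) {ρ : ℝ} (hρ : 0 < ρ) (x : ℝ) :
    JJ s (fun x => v ((x-t)/ρ)) x = ρ ^ (-(2*s)) * JJ s v ((x-t)/ρ) := by
  unfold JJ
  have := integral_comp_mul_left_Ioi
    (fun y => (2 * v ((x-t)/ρ) - v ((x+y-t)/ρ) - v ((x-y-t)/ρ)) * y ^ (-1 - 2*s)) 0 hρ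
  rw [mul_zero, smul_eq_mul] at this
  have h2 := congrArg (fun z => ρ * z) this
  simp only [← mul_assoc, mul_inv_cancel₀ hρ.ne', one_mul] at h2
  rw [← h2, ← integral_const_mul, ← integral_const_mul]
  refine setIntegral_congr_fun measurableSet_Ioi (fun y hy => ?_)
  rw [Real.mul_rpow hρ.le (le_of_lt hy), show (x + ρ*y - t)/ρ = (x-t)/ρ + y by field_simp; ring,
    show (x - ρ*y - t)/ρ = (x-t)/ρ - y by field_simp; ring,
    show -(2*s) = 1 + (-1 - 2*s) by ring, Real.rpow_add hρ, Real.rpow_one]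
  ring

lemma exists_bump {s : ℝ} (hs : s ∈ Set.Ioo (0:ℝ) 1) :
    ∃ η : ℝ → ℝ, ContDiff ℝ 2 η ∧ (∀ x, 0 ≤ η x) ∧ (∀ x, η x ≤ 1) ∧ η 0 = 1 ∧
      (∀ x, 1 ≤ |x| → η x = 0) ∧ ∃ M : ℝ, 0 < M ∧ ∀ x, |JJ s η x| ≤ M := by
  let b : ContDiffBump (0:ℝ) := ⟨1/2, 1, by norm_num, by norm_num⟩
  have hb : ContDiff ℝ 2 (b : ℝ → ℝ) := b.contDiff
  have hd : ContDiff ℝ 1 (deriv (b : ℝ → ℝ)) := by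
    have : ContDiff ℝ (1+1) (b : ℝ → ℝ) := by simpa [one_add_one_eq_two] using hb
    exact (contDiff_succ_iff_deriv.mp this).2.2
  obtain ⟨K, hK⟩ := hd.lipschitzWith_of_hasCompactSupport b.hasCompactSupport.deriv (by norm_num)
  have hB : ∀ x, |b x| ≤ 1 := fun x => by
    rw [abs_of_nonneg b.nonneg]; exact b.le_one
  refine ⟨b, hb, fun x => b.nonneg, fun x => b.le_one, ?_, ?_,
    |∫ y in Set.Ioi (0:ℝ), domF s K 1 y| + 1, by positivity, ?_⟩
  · exact b.one_of_mem_closedBall (Metric.mem_closedBall_self (by norm_num))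
  · intro x hx
    exact b.zero_of_le_dist (by simpa [Real.dist_eq, b] using hx)
  · intro x
    have : ‖JJ s b x‖ ≤ ∫ y in Set.Ioi (0:ℝ), domF s K 1 y := by
      refine norm_integral_le_of_norm_le (domF_int hs K 1) ?_
      refine (ae_restrict_iff' measurableSet_Ioi).mpr (Eventually.of_forall fun y hy => ?_)
      refine dom_bound (hb.differentiable (by norm_num)) K.2 hB ?_ hy
      intro a _ c _
      simpa [Real.dist_eq] using hK.dist_le_mul a c
    rw [Real.norm_eq_abs] at this
    linarith [le_abs_self (∫ y in Set.Ioi (0:ℝ), domF s K 1 y)]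

/-- global max exists inside the ball. -/
lemma exists_max {u : ℝ → ℝ} (hu : Continuous u) {t ρ m : ℝ} (hρ : 0 < ρ)
    (ht : m < u t) (hout : ∀ x, ρ ≤ |x - t| → u x ≤ m) :
    ∃ x0, |x0 - t| < ρ ∧ u t ≤ u x0 ∧ ∀ x, u x ≤ u x0 := by
  obtain ⟨x0, h0, hmax⟩ := (isCompact_Icc (a := t-ρ) (b := t+ρ)).exists_isMaxOn
    ⟨t, by constructor <;> linarith⟩ hu.continuousOn
  have h1 : u t ≤ u x0 := hmax (show t ∈ Set.Icc (t-ρ) (t+ρ) by constructor <;> linarith)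
  refine ⟨x0, ?_, h1, fun x => ?_⟩
  · by_contra hc
    linarith [hout x0 (not_lt.mp hc)]
  · by_cases hx : ρ ≤ |x - t|
    · linarith [hout x hx]
    · have := abs_lt.mp (not_le.mp hx)
      exact hmax (show x ∈ Set.Icc (t-ρ) (t+ρ) by constructor <;> linarith [this.1, this.2])

/-- For every bump scale there is a nearby point with controlled fractional Laplacian. -/
lemma touch {s : ℝ} (hs : s ∈ Set.Ioo (0:ℝ) 1) :
    ∃ M : ℝ, 0 < M ∧ ∀ u : ℝ → ℝ, ContDiff ℝ 2 u → (∀ x, |u x| < 1) → ∀ t ρ : ℝ, 0 < ρ →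
      ∃ x0, |x0 - t| < ρ ∧ u t ≤ u x0 ∧ -(M * ρ ^ (-(2*s))) ≤ JJ s u x0 := by
  obtain ⟨η, hη, hη0, hη1, hη00, hηout, M, hM, hJ⟩ := exists_bump hs
  refine ⟨2 * M, by positivity, fun u hu hub t ρ hρ => ?_⟩
  have hw : ContDiff ℝ 2 (fun x => η ((x-t)/ρ)) := by fun_prop
  have hwb : ∀ x, |η ((x-t)/ρ)| ≤ 1 := fun x => by rw [abs_of_nonneg (hη0 _)]; exact hη1 _
  have hg : Continuous (fun x => u x + 2 * η ((x-t)/ρ)) := by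
    have := hu.continuous; have := hw.continuous; fun_prop
  obtain ⟨x0, hx0, h1, h2⟩ := exists_max (u := fun x => u x + 2 * η ((x-t)/ρ)) hg (t := t) (m := 1)
    hρ (by simp only [sub_self, zero_div, hη00]; linarith [(abs_lt.mp (hub t)).1]) (by
      intro x hx
      have : η ((x-t)/ρ) = 0 := hηout _ (by rw [abs_div, abs_of_pos hρ, le_div_iff₀ hρ]; linarith)
      simp only [this]; linarith [(abs_lt.mp (hub x)).2])
  refine ⟨x0, hx0, ?_, ?_⟩
  · simp only [sub_self, zero_div, hη00] at h1
    linarith [hη1 ((x0-t)/ρ)]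
  · have ha := JJ_add hs hu (fun x => (hub x).le) hw hwb 2 x0
    rw [JJ_scale η t hρ x0] at ha
    have hp : 0 ≤ JJ s (fun x => u x + 2 * η ((x-t)/ρ)) x0 := by
      refine setIntegral_nonneg measurableSet_Ioi (fun y hy => ?_)
      refine mul_nonneg ?_ (Real.rpow_nonneg (le_of_lt hy) _)
      have := h2 (x0 + y); have := h2 (x0 - y)
      simp only at *
      linarith
    have h3 := (abs_le.mp (hJ ((x0-t)/ρ))).2
    have h4 : 0 ≤ ρ ^ (-(2*s)) := Real.rpow_nonneg hρ.le _
    nlinarith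

/-- Lower bound mechanism. -/
lemma touch_low {s : ℝ} (hs : s ∈ Set.Ioo (0:ℝ) 1) :
    ∃ M : ℝ, 0 < M ∧ ∀ u : ℝ → ℝ, ContDiff ℝ 2 u → (∀ x, |u x| < 1) → Monotone u →
      ∀ t h : ℝ, 2 < t → 0 < h → 1 - u t < h →
      ∃ x0, |x0 - t| < 1 ∧ 1 - u x0 < h ∧
        (1 - u 0) * ((t+1) ^ (-(2*s)) / (2*s)) - h * M ≤ JJ s u x0 := by
  obtain ⟨η, hη, hη0, hη1, hη00, hηout, M, hM, hJ⟩ := exists_bump hs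
  refine ⟨M, hM, fun u hu hub hmono t h ht hh hth => ?_⟩
  have hw : ContDiff ℝ 2 (fun x => η ((x-t)/1)) := by fun_prop
  have hwb : ∀ x, |η ((x-t)/1)| ≤ 1 := fun x => by rw [abs_of_nonneg (hη0 _)]; exact hη1 _
  set g : ℝ → ℝ := fun x => u x + h * η ((x-t)/1) with hgdef
  have hg2 : ContDiff ℝ 2 g := by fun_prop
  have hout : ∀ x, 1 ≤ |x - t| → g x = u x := by
    intro x hx
    have : η ((x-t)/1) = 0 := hηout _ (by simpa using hx)
    simp only [hgdef, this, mul_zero, add_zero]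
  have hgt : 1 < g t := by simp only [hgdef, sub_self, zero_div, hη00]; linarith
  obtain ⟨x0, hx0, h1, h2⟩ := exists_max hg2.continuous (m := 1) one_pos hgt (by
      intro x hx
      rw [hout x hx]; exact (abs_lt.mp (hub x)).2.le)
  have hgx : 1 < g x0 := lt_of_lt_of_le hgt h1
  refine ⟨x0, hx0, ?_, ?_⟩
  · have := hη1 ((x0-t)/1)
    simp only [hgdef] at hgx
    nlinarith
  · have ha := JJ_add hs hu (fun x => (hub x).le) hw hwb h x0
    rw [JJ_scale η t one_pos x0, Real.one_rpow, one_mul] at ha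
    have hgB : ∀ x, |g x| ≤ 1 + h := fun x => by
      have a1 := abs_lt.mp (hub x); have a2 := hη0 ((x-t)/1); have a3 := hη1 ((x-t)/1)
      rw [abs_le]; simp only [hgdef]
      constructor <;> nlinarith
    have hgi := JJ_int hs hg2 hgB x0
    have hx0' := abs_lt.mp hx0
    have hp : (1 - u 0) * ((t+1) ^ (-(2*s)) / (2*s)) ≤ JJ s g x0 := by
      have hI : ∫ y in Set.Ioi (t+1), y ^ (-1 - 2*s) = (t+1) ^ (-(2*s)) / (2*s) := by
        rw [integral_Ioi_rpow_of_lt (by linarith [hs.1]) (by linarith)]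
        rw [show -1 - 2*s + 1 = -(2*s) by ring]
        rw [div_neg, neg_div, neg_neg]
      rw [← hI, ← integral_const_mul]
      have hsub : Set.Ioi (t+1) ⊆ Set.Ioi (0:ℝ) := Set.Ioi_subset_Ioi (by linarith)
      calc _ ≤ ∫ y in Set.Ioi (t+1), (2 * g x0 - g (x0 + y) - g (x0 - y)) * y ^ (-1 - 2*s) := by
            refine setIntegral_mono_on
              ((integrableOn_Ioi_rpow_of_lt (by linarith [hs.1]) (by linarith)).const_mul _)
              (hgi.mono_set hsub) measurableSet_Ioi (fun y hy => ?_)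
            have hy' : t + 1 < y := hy
            refine mul_le_mul_of_nonneg_right ?_ (Real.rpow_nonneg (by linarith) _)
            have b1 := h2 (x0 + y)
            have b2 : g (x0 - y) = u (x0 - y) := hout _ (by
              rw [le_abs]; right; linarith)
            have b3 : u (x0 - y) ≤ u 0 := hmono (by linarith)
            linarith
        _ ≤ _ := by
            refine setIntegral_mono_set hgi ?_ hsub.eventuallyLE
            refine (ae_restrict_iff' measurableSet_Ioi).mpr (Eventually.of_forall fun y hy => ?_)
            refine mul_nonneg ?_ (Real.rpow_nonneg (le_of_lt hy) _)
            have := h2 (x0 + y); have := h2 (x0 - y)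
            linarith
    have h3 := (abs_le.mp (hJ ((x0-t)/1))).2
    nlinarith

lemma layer_strictMono {s : ℝ} {f v : ℝ → ℝ} (hv : IsLayerSolution s f v) : StrictMono v :=
  strictMono_of_deriv_pos hv.mono

lemma layer_abs {s : ℝ} {f v : ℝ → ℝ} (hv : IsLayerSolution s f v) (x : ℝ) : |v x| < 1 := by
  have hm := layer_strictMono hv
  rw [abs_lt]
  constructor
  · have h1 : -1 ≤ v (x-1) := hm.monotone.le_of_tendsto hv.limNeg (x-1)
    linarith [hm (show x - 1 < x by linarith)]
  · have h1 : v (x+1) ≤ 1 := hm.monotone.ge_of_tendsto hv.limPos (x+1)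
    linarith [hm (show x < x + 1 by linarith)]

lemma layer_eqn {s : ℝ} {f v : ℝ → ℝ} (hv : IsLayerSolution s f v) (x : ℝ) :
    fracLapCoef s * JJ s v x = f (v x) := hv.eqn x

lemma layer_refl {s : ℝ} {f v : ℝ → ℝ} (hv : IsLayerSolution s f v) :
    IsLayerSolution s (fun r => - f (-r)) (fun x => - v (-x)) where
  bounded := by
    obtain ⟨M, hM⟩ := hv.bounded
    exact ⟨M, fun x => by simpa using hM (-x)⟩
  smooth := by have := hv.smooth; fun_prop
  eqn := fun x => by
    change fracLapCoef s * JJ s (fun x => - v (-x)) x = _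
    rw [JJ_neg (fun x => v (-x)), JJ_refl, mul_neg, layer_eqn hv, neg_neg]
  mono := fun x => by
    have h := ((hv.smooth.differentiable (by norm_num)) (-x)).hasDerivAt
    have h2 : HasDerivAt (fun x => - v (-x)) (deriv v (-x)) x := by
      have := (h.scomp x (hasDerivAt_neg x)).neg
      simpa [Function.comp_def, Pi.neg_def] using this
    rw [h2.deriv]; exact hv.mono _
  limNeg := by
    exact (hv.limPos.comp tendsto_neg_atBot_atTop).neg
  limPos := by
    have := (hv.limNeg.comp tendsto_neg_atTop_atBot).neg
    simpa [Function.comp_def] using this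

lemma layer_f_one {s : ℝ} (hs : s ∈ Set.Ioo (0:ℝ) 1) {f v : ℝ → ℝ} (hf : Continuous f)
    (hv : IsLayerSolution s f v) : f 1 = 0 := by
  obtain ⟨M, hM, hT⟩ := touch hs
  have hc := coef_pos hs
  have hlim : Tendsto (fun x => f (v x)) atTop (𝓝 (f 1)) := (hf.tendsto 1).comp hv.limPos
  have hz : Tendsto (fun ρ : ℝ => fracLapCoef s * (M * ρ ^ (-(2*s)))) atTop (𝓝 0) := by
    have := ((tendsto_rpow_neg_atTop (show 0 < 2*s by linarith [hs.1])).const_mul M).const_mul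
      (fracLapCoef s)
    simpa using this
  apply le_antisymm
  · by_contra hcon
    push Not at hcon
    obtain ⟨R, hR⟩ := eventually_atTop.mp (hlim.eventually (lt_mem_nhds (half_lt_self hcon)))
    obtain ⟨ρ, ⟨hρ1, hρ2⟩, hρ3⟩ := ((hz.eventually (gt_mem_nhds (half_pos hcon))).and
      (eventually_gt_atTop 0) |>.and (eventually_ge_atTop R)).exists
    obtain ⟨x0, hx0, -, h⟩ := hT (fun x => - v x) (by have := hv.smooth; fun_prop)
      (fun x => by simpa using layer_abs hv x) (2*ρ) ρ hρ2
    rw [JJ_neg] at h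
    have h1 := hR x0 (by linarith [(abs_lt.mp hx0).1])
    rw [← layer_eqn hv] at h1
    nlinarith
  · by_contra hcon
    push Not at hcon
    obtain ⟨R, hR⟩ := eventually_atTop.mp (hlim.eventually
      (gt_mem_nhds (show f 1 < f 1 / 2 by linarith)))
    obtain ⟨ρ, ⟨hρ1, hρ2⟩, hρ3⟩ := ((hz.eventually (gt_mem_nhds (show 0 < -(f 1 / 2) by linarith))).and
      (eventually_gt_atTop 0) |>.and (eventually_ge_atTop R)).exists
    obtain ⟨x0, hx0, -, h⟩ := hT v hv.smooth (layer_abs hv) (2*ρ) ρ hρ2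
    have h1 := hR x0 (by linarith [(abs_lt.mp hx0).1])
    rw [← layer_eqn hv] at h1
    nlinarith

lemma one_side {s : ℝ} (hs : s ∈ Set.Ioo (0:ℝ) 1) {f v : ℝ → ℝ} (hf : Differentiable ℝ f)
    (hfp : deriv f 1 < 0) (hv : IsLayerSolution s f v) :
    ∃ c C : ℝ, 0 < c ∧ ∀ x : ℝ, 1 < x →
        c * x ^ (-(2*s)) ≤ 1 - v x ∧ 1 - v x ≤ C * x ^ (-(2*s)) := by
  have hf1 := layer_f_one hs hf.continuous hv
  have hc := coef_pos hs
  have hs0 := hs.1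
  obtain ⟨a, ha, ha'⟩ : ∃ a : ℝ, 0 < a ∧ deriv f 1 = -2 * a :=
    ⟨- deriv f 1 / 2, by linarith, by ring⟩
  have hlin : ∀ᶠ r in 𝓝 (1:ℝ), |f r - f 1 - (r - 1) * deriv f 1| ≤ a * |r - 1| := by
    have := (hf 1).hasDerivAt.isLittleO.def ha
    simpa [Real.norm_eq_abs] using this
  obtain ⟨R, hR⟩ := eventually_atTop.mp (hv.limPos.eventually hlin)
  have hv1 : ∀ x, 0 < 1 - v x := fun x => by linarith [(abs_lt.mp (layer_abs hv x)).2]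
  have hfb : ∀ x, R ≤ x → a * (1 - v x) ≤ f (v x) ∧ f (v x) ≤ 3 * a * (1 - v x) := by
    intro x hx
    have h := hR x hx
    rw [hf1, ha', abs_sub_comm (v x) 1, abs_of_pos (hv1 x)] at h
    have := abs_le.mp h
    constructor <;> nlinarith
  obtain ⟨M, hM, hT⟩ := touch hs
  obtain ⟨M', hM', hT'⟩ := touch_low hs
  have hmono := (layer_strictMono hv).monotone
  set T : ℝ := 2 * |R| + 3 with hTdef
  have hRT := le_abs_self R
  have hR0 := abs_nonneg R
  have hT0 : 0 < T := by positivity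
  -- upper bound
  have hup : ∀ t, T ≤ t → 1 - v t ≤ (fracLapCoef s * M / a * (1/2) ^ (-(2*s))) * t ^ (-(2*s)) := by
    intro t ht
    obtain ⟨x0, hx0, hle, h⟩ := hT (fun x => - v x) (by have := hv.smooth; fun_prop)
      (fun x => by simpa using layer_abs hv x) t ((1/2) * t) (by linarith)
    rw [JJ_neg, Real.mul_rpow (by norm_num) (by linarith)] at h
    have h1 := (hfb x0 (by linarith [(abs_lt.mp hx0).1])).1
    rw [← layer_eqn hv] at h1
    have h2 : a * (1 - v t) ≤ a * (1 - v x0) := by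
      apply mul_le_mul_of_nonneg_left _ ha.le; linarith
    have h3 : fracLapCoef s * JJ s v x0 ≤
      fracLapCoef s * (M * ((1/2) ^ (-(2*s)) * t ^ (-(2*s)))) :=
      mul_le_mul_of_nonneg_left (by linarith) hc.le
    have h4 : 1 - v t ≤ fracLapCoef s * (M * ((1/2) ^ (-(2*s)) * t ^ (-(2*s)))) / a := by
      rw [le_div_iff₀ ha]; linarith
    calc _ ≤ _ := h4
      _ = _ := by ring
  -- lower bound
  obtain ⟨c1, hc1, hlow⟩ : ∃ c1 : ℝ, 0 < c1 ∧ ∀ t, T ≤ t → c1 * t ^ (-(2*s)) ≤ 1 - v t := by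
    have hD : 0 < 3 * a + fracLapCoef s * M' := by positivity
    refine ⟨fracLapCoef s * (1 - v 0) * (2 ^ (-(2*s)) / (2*s)) / (3 * a + fracLapCoef s * M'), ?_,
      fun t ht => ?_⟩
    · have := hv1 0
      positivity
    · refine le_of_forall_gt fun h hh => ?_
      have hh0 : 0 < h := (hv1 t).trans hh
      obtain ⟨x0, hx0, hx1, hJ⟩ := hT' v hv.smooth (layer_abs hv) hmono t h (by linarith) hh0 hh
      have h1 := (hfb x0 (by linarith [(abs_lt.mp hx0).1])).2
      rw [← layer_eqn hv] at h1
      have h2 : (2 * t) ^ (-(2*s)) ≤ (t+1) ^ (-(2*s)) :=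
        Real.rpow_le_rpow_of_nonpos (by linarith) (by linarith) (by linarith)
      rw [Real.mul_rpow (by norm_num) (by linarith)] at h2
      have h3 : (1 - v 0) * ((2 ^ (-(2*s)) * t ^ (-(2*s))) / (2*s)) ≤
          (1 - v 0) * ((t+1) ^ (-(2*s)) / (2*s)) :=
        mul_le_mul_of_nonneg_left (div_le_div_of_nonneg_right h2 (by linarith)) (hv1 0).le
      have h4 := mul_le_mul_of_nonneg_left (h3.trans (sub_le_iff_le_add.mp hJ)) hc.le
      have h5 : 3 * a * (1 - v x0) < 3 * a * h := mul_lt_mul_of_pos_left hx1 (by positivity)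
      rw [div_mul_eq_mul_div, div_lt_iff₀ hD]
      calc _ = fracLapCoef s * ((1 - v 0) * ((2 ^ (-(2*s)) * t ^ (-(2*s))) / (2*s))) := by ring
        _ ≤ _ := h4
        _ < _ := by linarith
  refine ⟨min c1 (1 - v T), max (fracLapCoef s * M / a * (1/2) ^ (-(2*s))) (2 * T ^ (2*s)),
    lt_min hc1 (hv1 T), fun x hx => ?_⟩
  have hx0 : 0 < x := by linarith
  have hp : 0 < x ^ (-(2*s)) := Real.rpow_pos_of_pos hx0 _
  rcases le_total T x with hxT | hxT
  · constructor
    · exact le_trans (mul_le_mul_of_nonneg_right (min_le_left _ _) hp.le) (hlow x hxT)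
    · exact le_trans (hup x hxT) (mul_le_mul_of_nonneg_right (le_max_left _ _) hp.le)
  · constructor
    · have h1 : x ^ (-(2*s)) ≤ 1 := Real.rpow_le_one_of_one_le_of_nonpos hx.le (by linarith)
      have h2 := hmono hxT
      have h3 := min_le_right c1 (1 - v T)
      have h4 := lt_min hc1 (hv1 T)
      nlinarith
    · have h1 : 1 ≤ T ^ (2*s) * x ^ (-(2*s)) := by
        rw [Real.rpow_neg hx0.le, ← div_eq_mul_inv, le_div_iff₀ (by positivity), one_mul]
        exact Real.rpow_le_rpow hx0.le hxT (by linarith)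
      have h2 : 2 * T ^ (2*s) * x ^ (-(2*s)) ≤ max (fracLapCoef s * M / a * (1/2) ^ (-(2*s)))
        (2 * T ^ (2*s)) * x ^ (-(2*s)) := mul_le_mul_of_nonneg_right (le_max_right _ _) hp.le
      linarith [(abs_lt.mp (layer_abs hv x)).1]

/-- Asymptotic behavior of a layer solution at infinity. -/
theorem statement5 (s γ : ℝ) (hs : s ∈ Set.Ioo (0:ℝ) 1)
    (hγ : max 0 (1 - 2*s) < γ)
    (f : ℝ → ℝ) (hf : IsC1Holder γ f)
    (hfm : deriv f (-1) < 0) (hfp : deriv f 1 < 0)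
    (v : ℝ → ℝ) (hv : IsLayerSolution s f v) :
    ∃ c C : ℝ, 0 < c ∧ c ≤ C ∧
      (∀ x : ℝ, 1 < x →
        c * x ^ (-(2*s)) ≤ 1 - v x ∧ 1 - v x ≤ C * x ^ (-(2*s))) ∧
      (∀ x : ℝ, x < -1 →
        c * |x| ^ (-(2*s)) ≤ 1 + v x ∧ 1 + v x ≤ C * |x| ^ (-(2*s))) := by
  have hd : Differentiable ℝ f := hf.1.differentiable (by norm_num)
  obtain ⟨c1, C1, hc1, h1⟩ := one_side hs hd hfp hv
  have hder : HasDerivAt (fun r => - f (-r)) (deriv f (-1)) 1 := by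
    have := ((hd (-1)).hasDerivAt.scomp (1:ℝ) (hasDerivAt_neg (1:ℝ))).neg
    simpa [Function.comp_def, Pi.neg_def] using this
  obtain ⟨c2, C2, hc2, h2⟩ := one_side hs (f := fun r => - f (-r)) (by fun_prop)
    (by rw [hder.deriv]; exact hfm) (layer_refl hv)
  have hC1 : C1 ≤ max (max C1 C2) (min c1 c2) := (le_max_left _ _).trans (le_max_left _ _)
  have hC2 : C2 ≤ max (max C1 C2) (min c1 c2) := (le_max_right _ _).trans (le_max_left _ _)
  refine ⟨min c1 c2, max (max C1 C2) (min c1 c2), lt_min hc1 hc2, le_max_right _ _, ?_, ?_⟩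
  · intro x hx
    have hp : 0 ≤ x ^ (-(2*s)) := Real.rpow_nonneg (by linarith) _
    exact ⟨(mul_le_mul_of_nonneg_right (min_le_left _ _) hp).trans (h1 x hx).1,
      (h1 x hx).2.trans (mul_le_mul_of_nonneg_right hC1 hp)⟩
  · intro x hx
    have h := h2 (-x) (by linarith)
    rw [neg_neg, sub_neg_eq_add] at h
    rw [abs_of_neg (by linarith)]
    have hp : 0 ≤ (-x) ^ (-(2*s)) := Real.rpow_nonneg (by linarith) _
    exact ⟨(mul_le_mul_of_nonneg_right (min_le_right _ _) hp).trans h.1,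
      h.2.trans (mul_le_mul_of_nonneg_right hC2 hp)⟩
end
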